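/- Let D = (E, 𝓕) be a delta-matroid and let < be any total order on E. Then for all real numbers x ≠ 0 and all real y, the two-variable interlace polynomial satisfies: q̄(D;x,y) = Σ_{F ∈ 𝓕} x^{|F|} (1 + y/x)^{i(F)} (1 + xy)^{j(F)}. -/

import Mathlib

open Finset

/-- The symmetric exchange axiom for a collection of feasible sets. -/
def SymExch {α : Type*} [DecidableEq α] (𝓕 : Finset (Finset α)) : Prop :=
  ∀ X ∈ 𝓕, ∀ Y ∈ 𝓕, ∀ a ∈ symmDiff X Y, ∃ b ∈ symmDiff X Y, symmDiff X {a, b} ∈ 𝓕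

/-- A point `a` is `F`-nonorientable if `F Δ {a}` is feasible. -/
def FNonorientable {α : Type*} [DecidableEq α] (𝓕 : Finset (Finset α))
    (F : Finset α) (a : α) : Prop :=
  symmDiff F {a} ∈ 𝓕

/-- Distinct points `a` and `b` are `F`-interlaced if either at most one of
them is `F`-nonorientable and `F Δ {a,b}` is feasible, or both are
`F`-nonorientable and `F Δ {a,b}` is not feasible. -/
def FInterlaced {α : Type*} [DecidableEq α] (𝓕 : Finset (Finset α))
    (F : Finset α) (a b : α) : Prop :=
  a ≠ b ∧
    ((¬(FNonorientable 𝓕 F a ∧ FNonorientable 𝓕 F b) ∧ symmDiff F {a, b} ∈ 𝓕) ∨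
      (FNonorientable 𝓕 F a ∧ FNonorientable 𝓕 F b ∧ symmDiff F {a, b} ∉ 𝓕))

/-- A point is active with respect to `F` if no lower-ordered point is
`F`-interlaced with it. -/
def ActiveWrt {α : Type*} [LinearOrder α] (𝓕 : Finset (Finset α))
    (F : Finset α) (a : α) : Prop :=
  ∀ b, b < a → ¬ FInterlaced 𝓕 F b a

open Classical in
/-- The number of points of `A` that are active with respect to `F` and
`F`-orientable. -/
noncomputable def numActOr {α : Type*} [LinearOrder α] (𝓕 : Finset (Finset α))
    (F A : Finset α) : ℕ :=
  (A.filter fun a => ActiveWrt 𝓕 F a ∧ ¬ FNonorientable 𝓕 F a).card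

/-- `dmin 𝓕 B` is the minimum cardinality of `F Δ B` over feasible `F`. -/
noncomputable def dmin {α : Type*} [DecidableEq α] (𝓕 : Finset (Finset α))
    (B : Finset α) : ℕ :=
  sInf {n | ∃ F ∈ 𝓕, (symmDiff F B).card = n}

/-- The two-variable interlace polynomial `q̄(D;x,y)`, as a real-valued
function. -/
noncomputable def interlaceQ {α : Type*} [DecidableEq α] (E : Finset α)
    (𝓕 : Finset (Finset α)) (x y : ℝ) : ℝ :=
  ∑ A ∈ E.powerset, x ^ A.card * y ^ dmin 𝓕 A


section helpers
variable {α : Type*} [LinearOrder α]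

lemma dmin_le {𝓕 : Finset (Finset α)} {F : Finset α} (h : F ∈ 𝓕) (B : Finset α) :
    dmin 𝓕 B ≤ (symmDiff F B).card := Nat.sInf_le ⟨F, h, rfl⟩

lemma dmin_attained {𝓕 : Finset (Finset α)} (h : 𝓕.Nonempty) (B : Finset α) :
    ∃ F ∈ 𝓕, (symmDiff F B).card = dmin 𝓕 B := by
  obtain ⟨F, hF⟩ := h
  exact Nat.sInf_mem (s := {n | ∃ F ∈ 𝓕, (symmDiff F B).card = n}) ⟨_, F, hF, rfl⟩

/-- deletion -/
def delF (e : α) (𝓕 : Finset (Finset α)) : Finset (Finset α) := 𝓕.filter (fun F => e ∉ F)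
/-- contraction -/
def conF (e : α) (𝓕 : Finset (Finset α)) : Finset (Finset α) :=
  (𝓕.filter (fun F => e ∈ F)).image (fun F => F.erase e)

lemma mem_delF {e : α} {𝓕 : Finset (Finset α)} {F : Finset α} :
    F ∈ delF e 𝓕 ↔ F ∈ 𝓕 ∧ e ∉ F := by simp [delF]

lemma mem_conF {e : α} {𝓕 : Finset (Finset α)} {F : Finset α} :
    F ∈ conF e 𝓕 ↔ insert e F ∈ 𝓕 ∧ e ∉ F := by
  simp only [conF, mem_image, mem_filter]
  constructor
  · rintro ⟨G, ⟨hG, heG⟩, rfl⟩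
    simp [insert_erase heG, hG]
  · rintro ⟨h, he⟩
    exact ⟨insert e F, ⟨h, by simp⟩, by simp [he]⟩

lemma sd_insert_left {e : α} {F S : Finset α} (hF : e ∉ F) (hS : e ∉ S) :
    symmDiff (insert e F) S = insert e (symmDiff F S) := by
  ext c; by_cases hc : c = e <;> simp_all [mem_symmDiff]

lemma sd_insert_right {e : α} {F S : Finset α} (hF : e ∉ F) (hS : e ∉ S) :
    symmDiff F (insert e S) = insert e (symmDiff F S) := by
  rw [symmDiff_comm, sd_insert_left hS hF, symmDiff_comm]

lemma sd_insert_both {e : α} {F S : Finset α} (hF : e ∉ F) (hS : e ∉ S) :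
    symmDiff (insert e F) (insert e S) = symmDiff F S := by
  ext c; by_cases hc : c = e <;> simp_all [mem_symmDiff]

lemma sd_notMem {e : α} {F S : Finset α} (hF : e ∉ F) (hS : e ∉ S) :
    e ∉ symmDiff F S := by simp_all [mem_symmDiff]

lemma delF_symExch {e : α} {𝓕 : Finset (Finset α)} (h : SymExch 𝓕) : SymExch (delF e 𝓕) := by
  intro X hX Y hY a ha
  rw [mem_delF] at hX hY
  obtain ⟨b, hb, hb'⟩ := h X hX.1 Y hY.1 a ha
  have h1 := sd_notMem hX.2 hY.2
  refine ⟨b, hb, mem_delF.2 ⟨hb', sd_notMem hX.2 ?_⟩⟩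
  simp only [mem_insert, mem_singleton]
  rintro (rfl | rfl) <;> contradiction

lemma conF_symExch {e : α} {𝓕 : Finset (Finset α)} (h : SymExch 𝓕) : SymExch (conF e 𝓕) := by
  intro X hX Y hY a ha
  rw [mem_conF] at hX hY
  rw [← sd_insert_both hX.2 hY.2] at ha
  obtain ⟨b, hb, hb'⟩ := h _ hX.1 _ hY.1 a ha
  rw [sd_insert_both hX.2 hY.2] at hb ha
  have h1 := sd_notMem hX.2 hY.2
  have h2 : e ∉ ({a, b} : Finset α) := by
    simp only [mem_insert, mem_singleton]
    rintro (rfl | rfl) <;> contradiction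
  exact ⟨b, hb, mem_conF.2 ⟨by rwa [← sd_insert_left hX.2 h2], sd_notMem hX.2 h2⟩⟩

lemma dist_le {e b : α} (F A : Finset α) (he : e ∈ symmDiff F A) :
    (symmDiff (symmDiff F {e, b}) A).card ≤ (symmDiff F A).card := by
  have h : symmDiff (symmDiff F {e, b}) A ⊆ insert b ((symmDiff F A).erase e) := by
    intro c
    simp only [mem_symmDiff, mem_insert, mem_singleton, mem_erase] at he ⊢
    grind
  refine (card_le_card h).trans ((card_insert_le _ _).trans ?_)
  rw [card_erase_of_mem he]
  have := card_pos.2 ⟨e, he⟩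
  omega

/-- nearest feasible set agreeing with A at e -/
lemma dmin_agree {e : α} {𝓕 : Finset (Finset α)} (h : SymExch 𝓕) (A : Finset α)
    (hG : ∃ G ∈ 𝓕, e ∉ symmDiff G A) :
    ∃ F ∈ 𝓕, e ∉ symmDiff F A ∧ (symmDiff F A).card = dmin 𝓕 A := by
  obtain ⟨G, hG, hGe⟩ := hG
  obtain ⟨F, hF, hd⟩ := dmin_attained ⟨G, hG⟩ A
  by_cases he : e ∈ symmDiff F A
  · have heFG : e ∈ symmDiff F G := by
      simp only [mem_symmDiff] at *; grind
    obtain ⟨b, hb, hb'⟩ := h F hF G hG e heFG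
    refine ⟨_, hb', ?_, le_antisymm (hd ▸ dist_le F A he) (dmin_le hb' A)⟩
    simp only [mem_symmDiff, mem_insert] at *; grind
  · exact ⟨F, hF, he, hd⟩

lemma dmin_del {e : α} {𝓕 : Finset (Finset α)} (h : SymExch 𝓕) {A : Finset α} (he : e ∉ A)
    (hn : (delF e 𝓕).Nonempty) : dmin 𝓕 A = dmin (delF e 𝓕) A := by
  obtain ⟨G, hG⟩ := hn
  obtain ⟨F, hF, hd⟩ := dmin_attained ⟨G, hG⟩ A
  rw [mem_delF] at hF hG
  obtain ⟨F', hF', hn, hd'⟩ := dmin_agree h A ⟨G, hG.1, sd_notMem hG.2 he⟩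
  apply le_antisymm
  · exact hd ▸ dmin_le hF.1 A
  · rw [← hd']
    refine dmin_le (mem_delF.2 ⟨hF', ?_⟩) A
    simp only [mem_symmDiff] at hn; tauto

lemma dmin_con {e : α} {𝓕 : Finset (Finset α)} (h : SymExch 𝓕) {A : Finset α} (he : e ∉ A)
    (hn : (conF e 𝓕).Nonempty) : dmin 𝓕 (insert e A) = dmin (conF e 𝓕) A := by
  obtain ⟨G, hG⟩ := hn
  obtain ⟨F, hF, hd⟩ := dmin_attained ⟨G, hG⟩ A
  rw [mem_conF] at hF hG
  obtain ⟨F', hF', hn, hd'⟩ := dmin_agree h (insert e A)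
    ⟨_, hG.1, by rw [sd_insert_both hG.2 he]; exact sd_notMem hG.2 he⟩
  apply le_antisymm
  · rw [← hd, ← sd_insert_both hF.2 he]; exact dmin_le hF.1 _
  · have hm : e ∈ F' := by simp only [mem_symmDiff, mem_insert] at hn; tauto
    rw [← hd', ← insert_erase hm, sd_insert_both (notMem_erase _ _) he]
    refine dmin_le (mem_conF.2 ⟨by rwa [insert_erase hm], notMem_erase _ _⟩) A

lemma dmin_loop {e : α} {𝓕 : Finset (Finset α)} {A : Finset α} (he : e ∉ A)
    (hne : 𝓕.Nonempty) (hn : ∀ F ∈ 𝓕, e ∉ F) : dmin 𝓕 (insert e A) = dmin 𝓕 A + 1 := by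
  have key : ∀ F ∈ 𝓕, (symmDiff F (insert e A)).card = (symmDiff F A).card + 1 := by
    intro F hF
    rw [sd_insert_right (hn F hF) he, card_insert_of_notMem (sd_notMem (hn F hF) he)]
  obtain ⟨F, hF, hd⟩ := dmin_attained hne A
  obtain ⟨G, hG, hd'⟩ := dmin_attained hne (insert e A)
  have h1 := dmin_le hF (insert e A)
  have h2 := dmin_le hG A
  rw [key _ hF] at h1
  rw [key _ hG] at hd'
  omega

lemma dmin_coloop {e : α} {𝓕 : Finset (Finset α)} {A : Finset α} (he : e ∉ A)
    (hne : 𝓕.Nonempty) (hn : ∀ F ∈ 𝓕, e ∈ F) : dmin 𝓕 A = dmin 𝓕 (insert e A) + 1 := by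
  have key : ∀ F ∈ 𝓕, (symmDiff F A).card = (symmDiff F (insert e A)).card + 1 := by
    intro F hF
    rw [← insert_erase (hn F hF), sd_insert_both (notMem_erase _ _) he,
      sd_insert_left (notMem_erase _ _) he,
      card_insert_of_notMem (sd_notMem (notMem_erase _ _) he)]
  obtain ⟨F, hF, hd⟩ := dmin_attained hne A
  obtain ⟨G, hG, hd'⟩ := dmin_attained hne (insert e A)
  have h1 := dmin_le hF (insert e A)
  have h2 := dmin_le hG A
  rw [key _ hF] at hd
  rw [key _ hG] at h2
  omega

lemma numActOr_congr {e : α} {𝓕 𝓕' : Finset (Finset α)} {F F' A : Finset α}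
    (h : ∀ S : Finset α, e ∉ S → (symmDiff F S ∈ 𝓕 ↔ symmDiff F' S ∈ 𝓕'))
    (hA : ∀ a ∈ A, a < e) : numActOr 𝓕 F A = numActOr 𝓕' F' A := by
  unfold numActOr
  congr 1
  refine @filter_congr _ _ _ (_) (_) _ ?_
  intro a ha
  have hae := hA a ha
  have h1 : ∀ c < e, (FNonorientable 𝓕 F c ↔ FNonorientable 𝓕' F' c) := by
    intro c hc
    exact h _ (by simpa using hc.ne')
  have h2 : ∀ b < a, (FInterlaced 𝓕 F b a ↔ FInterlaced 𝓕' F' b a) := by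
    intro b hb
    have := h {b, a} (by simp [hae.ne', (hb.trans hae).ne'])
    unfold FInterlaced
    rw [h1 a hae, h1 b (hb.trans hae), this]
  rw [h1 a hae]
  refine and_congr_left fun _ => ?_
  unfold ActiveWrt
  exact forall_congr' fun b => imp_congr_right fun hb => not_congr (h2 b hb)

lemma numActOr_insert_neg {e : α} {𝓕 : Finset (Finset α)} {F A : Finset α}
    (h : ¬ (ActiveWrt 𝓕 F e ∧ ¬ FNonorientable 𝓕 F e)) :
    numActOr 𝓕 F (insert e A) = numActOr 𝓕 F A := by
  unfold numActOr
  rw [filter_insert, if_neg h]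

lemma numActOr_insert_pos {e : α} {𝓕 : Finset (Finset α)} {F A : Finset α} (he : e ∉ A)
    (h : ActiveWrt 𝓕 F e ∧ ¬ FNonorientable 𝓕 F e) :
    numActOr 𝓕 F (insert e A) = numActOr 𝓕 F A + 1 := by
  unfold numActOr
  rw [filter_insert, if_pos h, card_insert_of_notMem (by simp [he])]

lemma not_act {e : α} {𝓕 : Finset (Finset α)} {E F G : Finset α} (h : SymExch 𝓕)
    (hE : ∀ F ∈ 𝓕, F ⊆ E) (hmax : ∀ a ∈ E, a ≤ e) (hF : F ∈ 𝓕) (hG : G ∈ 𝓕)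
    (he : e ∈ symmDiff F G) : ¬ (ActiveWrt 𝓕 F e ∧ ¬ FNonorientable 𝓕 F e) := by
  rintro ⟨h1, h2⟩
  obtain ⟨b, hb, hb'⟩ := h F hF G hG e he
  have hbe : b ≠ e := by
    rintro rfl
    exact h2 (by simpa [FNonorientable] using hb')
  have hbE : b ∈ E := by
    rw [mem_symmDiff] at hb
    rcases hb with hb | hb
    · exact hE F hF hb.1
    · exact hE G hG hb.1
  refine h1 b (lt_of_le_of_ne (hmax b hbE) hbe) ⟨hbe, Or.inl ⟨fun h => h2 h.2, ?_⟩⟩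
  rwa [pair_comm]

lemma act {e : α} {𝓕 : Finset (Finset α)} {F : Finset α}
    (h : ∀ G ∈ 𝓕, e ∉ symmDiff F G) : ActiveWrt 𝓕 F e ∧ ¬ FNonorientable 𝓕 F e := by
  have key : ∀ S : Finset α, e ∈ S → symmDiff F S ∉ 𝓕 := by
    intro S hS hm
    have := h _ hm
    rw [symmDiff_symmDiff_cancel_left] at this
    exact this hS
  have h2 : ¬ FNonorientable 𝓕 F e := key _ (by simp)
  refine ⟨fun b hb hi => ?_, h2⟩
  rcases hi.2 with h3 | h3
  · exact key _ (by simp) h3.2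
  · exact h2 h3.2.1

/-- the summand -/
noncomputable def wt (E : Finset α) (𝓕 : Finset (Finset α)) (x y : ℝ) (F : Finset α) : ℝ :=
  x ^ F.card * (1 + y / x) ^ numActOr 𝓕 F F * (1 + x * y) ^ numActOr 𝓕 F (E \ F)

lemma sum_split (e : α) (𝓕 : Finset (Finset α)) (f : Finset α → ℝ) :
    ∑ F ∈ 𝓕, f F = ∑ F ∈ delF e 𝓕, f F + ∑ F ∈ conF e 𝓕, f (insert e F) := by
  rw [← sum_filter_add_sum_filter_not 𝓕 (fun F => e ∉ F)]
  congr 1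
  unfold conF
  simp only [not_not]
  rw [sum_image]
  · refine sum_congr rfl fun F hF => ?_
    rw [insert_erase (mem_filter.1 hF).2]
  · intro A hA B hB hAB
    simp only [coe_filter, Set.mem_ofPred_eq] at hA hB
    rw [← insert_erase hA.2, ← insert_erase hB.2, show A.erase e = B.erase e from hAB]

lemma main_aux (x y : ℝ) (hx : x ≠ 0) (E : Finset α) : ∀ (𝓕 : Finset (Finset α))
    (_ : 𝓕.Nonempty) (_ : ∀ F ∈ 𝓕, F ⊆ E) (_ : SymExch 𝓕),
      interlaceQ E 𝓕 x y = ∑ F ∈ 𝓕, wt E 𝓕 x y F := by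
  induction E using Finset.induction_on_max with
  | empty =>
    intro 𝓕 hne hsub hex
    have : 𝓕 = {∅} := by
      apply Finset.eq_singleton_iff_nonempty_unique_mem.2 ⟨hne, fun F hF => ?_⟩
      exact subset_empty.1 (hsub F hF)
    subst this
    have := dmin_le (mem_singleton_self (∅ : Finset α)) ∅
    simp only [symmDiff_self, Finset.bot_eq_empty, card_empty, Nat.le_zero] at this
    simp [interlaceQ, wt, numActOr, this]
  | insert e s hs ih =>
    intro 𝓕 hne hsub hex
    have hes : e ∉ s := fun h => lt_irrefl _ (hs e h)
    have hmax : ∀ a ∈ insert e s, a ≤ e := by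
      intro a ha
      rcases mem_insert.1 ha with rfl | ha
      · exact le_rfl
      · exact (hs a ha).le
    have hsub0 : ∀ F ∈ delF e 𝓕, F ⊆ s := by
      intro F hF
      rw [mem_delF] at hF
      exact (subset_insert_iff_of_notMem hF.2).1 (hsub F hF.1)
    have hsub1 : ∀ F ∈ conF e 𝓕, F ⊆ s := by
      intro F hF
      rw [mem_conF] at hF
      exact (subset_insert_iff_of_notMem hF.2).1 ((subset_insert e F).trans (hsub _ hF.1))
    have ih0 := fun h => ih (delF e 𝓕) h hsub0 (delF_symExch hex)
    have ih1 := fun h => ih (conF e 𝓕) h hsub1 (conF_symExch hex)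
    have Q : interlaceQ (insert e s) 𝓕 x y = ∑ A ∈ s.powerset, x ^ A.card * y ^ dmin 𝓕 A
        + ∑ A ∈ s.powerset, x ^ A.card * x * y ^ dmin 𝓕 (insert e A) := by
      unfold interlaceQ
      rw [sum_powerset_insert hes]
      congr 1
      refine sum_congr rfl fun A hA => ?_
      rw [card_insert_of_notMem (fun h => hes (mem_powerset.1 hA h)), pow_succ]
    have hA : ∀ A ∈ s.powerset, e ∉ A := fun A hA h => hes (mem_powerset.1 hA h)
    -- numbers
    have n0 : ∀ F ∈ delF e 𝓕, ∀ A ⊆ s, numActOr 𝓕 F A = numActOr (delF e 𝓕) F A := by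
      intro F hF A hA
      refine numActOr_congr (e := e) (fun S hS => ?_) (fun a ha => hs a (hA ha))
      rw [mem_delF] at hF ⊢
      simp [sd_notMem hF.2 hS]
    have n1 : ∀ F ∈ conF e 𝓕, ∀ A ⊆ s,
        numActOr 𝓕 (insert e F) A = numActOr (conF e 𝓕) F A := by
      intro F hF A hA
      refine numActOr_congr (e := e) (fun S hS => ?_) (fun a ha => hs a (hA ha))
      rw [mem_conF] at hF ⊢
      rw [sd_insert_left hF.2 hS]
      simp [sd_notMem hF.2 hS]
    have d0 : ∀ F ∈ delF e 𝓕, insert e s \ F = insert e (s \ F) := fun F hF =>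
      insert_sdiff_of_notMem _ (mem_delF.1 hF).2
    have d1 : ∀ F ∈ conF e 𝓕, insert e s \ insert e F = s \ F := by
      intro F hF
      ext c
      by_cases hc : c = e <;> simp_all
    have c1 : ∀ F ∈ conF e 𝓕, (insert e F).card = F.card + 1 := fun F hF =>
      card_insert_of_notMem (mem_conF.1 hF).2
    rw [Q, sum_split e 𝓕]
    rcases (delF e 𝓕).eq_empty_or_nonempty with h0 | h0
    · have hall : ∀ F ∈ 𝓕, e ∈ F := by
        intro F hF
        by_contra hc
        have : F ∈ delF e 𝓕 := mem_delF.2 ⟨hF, hc⟩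
        simp [h0] at this
      have h1 : (conF e 𝓕).Nonempty := by
        obtain ⟨F, hF⟩ := hne
        exact ⟨F.erase e, mem_conF.2 ⟨by rwa [insert_erase (hall F hF)], notMem_erase _ _⟩⟩
      have hQ : ∑ A ∈ s.powerset, x ^ A.card * y ^ dmin 𝓕 A
        + ∑ A ∈ s.powerset, x ^ A.card * x * y ^ dmin 𝓕 (insert e A)
          = (x + y) * interlaceQ s (conF e 𝓕) x y := by
        unfold interlaceQ
        rw [← sum_add_distrib, mul_sum]
        refine sum_congr rfl fun A h => ?_
        rw [dmin_coloop (hA A h) hne hall, dmin_con hex (hA A h) h1]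
        ring
      rw [hQ, ih1 h1, h0, sum_empty, zero_add, mul_sum]
      refine sum_congr rfl fun F hF => ?_
      have hF' := mem_conF.1 hF
      unfold wt
      rw [d1 F hF, c1 F hF, n1 F hF _ sdiff_subset, numActOr_insert_pos hF'.2
        (act fun G hG => by simp [mem_symmDiff, hall G hG]), n1 F hF _ (hsub1 F hF)]
      rw [show x + y = x * (1 + y / x) by field_simp]
      ring
    · rcases (conF e 𝓕).eq_empty_or_nonempty with h1 | h1
      · have hall : ∀ F ∈ 𝓕, e ∉ F := by
          intro F hF hc
          have : F.erase e ∈ conF e 𝓕 :=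
            mem_conF.2 ⟨by rwa [insert_erase hc], notMem_erase _ _⟩
          simp [h1] at this
        have hQ : ∑ A ∈ s.powerset, x ^ A.card * y ^ dmin 𝓕 A
          + ∑ A ∈ s.powerset, x ^ A.card * x * y ^ dmin 𝓕 (insert e A)
            = (1 + x * y) * interlaceQ s (delF e 𝓕) x y := by
          unfold interlaceQ
          rw [← sum_add_distrib, mul_sum]
          refine sum_congr rfl fun A h => ?_
          rw [dmin_loop (hA A h) hne hall, dmin_del hex (hA A h) h0]
          ring
        rw [hQ, ih0 h0, h1, sum_empty, add_zero, mul_sum]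
        refine sum_congr rfl fun F hF => ?_
        have hF' := mem_delF.1 hF
        unfold wt
        rw [d0 F hF, numActOr_insert_pos (fun h => hes (mem_sdiff.1 h).1)
          (act fun G hG => by simp [mem_symmDiff, hall G hG, hF'.2]),
          n0 F hF _ sdiff_subset, n0 F hF _ (hsub0 F hF)]
        ring
      · have hQ : ∑ A ∈ s.powerset, x ^ A.card * y ^ dmin 𝓕 A
          + ∑ A ∈ s.powerset, x ^ A.card * x * y ^ dmin 𝓕 (insert e A)
            = interlaceQ s (delF e 𝓕) x y + x * interlaceQ s (conF e 𝓕) x y := by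
          unfold interlaceQ
          rw [mul_sum]
          congr 1
          · refine sum_congr rfl fun A h => ?_
            rw [dmin_del hex (hA A h) h0]
          · refine sum_congr rfl fun A h => ?_
            rw [dmin_con hex (hA A h) h1]
            ring
        rw [hQ, ih0 h0, ih1 h1, mul_sum]
        congr 1
        · refine sum_congr rfl fun F hF => ?_
          have hF' := mem_delF.1 hF
          obtain ⟨G, hG⟩ := h1
          rw [mem_conF] at hG
          unfold wt
          rw [d0 F hF, numActOr_insert_neg
            (not_act hex hsub hmax hF'.1 hG.1 (by simp [mem_symmDiff, hF'.2])),
            n0 F hF _ sdiff_subset, n0 F hF _ (hsub0 F hF)]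
        · refine sum_congr rfl fun F hF => ?_
          have hF' := mem_conF.1 hF
          obtain ⟨G, hG⟩ := h0
          rw [mem_delF] at hG
          unfold wt
          rw [d1 F hF, c1 F hF, n1 F hF _ sdiff_subset, numActOr_insert_neg
            (not_act hex hsub hmax hF'.1 hG.1 (by simp [mem_symmDiff, hG.2])),
            n1 F hF _ (hsub1 F hF)]
          ring

end helpers

/-- The activities-based feasible-set expansion of the two-variable
interlace polynomial. -/
theorem interlaceQ_feasibleSet_expansion {α : Type*} [LinearOrder α]
    (E : Finset α) (𝓕 : Finset (Finset α))
    (hne : 𝓕.Nonempty) (hsub : ∀ F ∈ 𝓕, F ⊆ E) (hex : SymExch 𝓕) :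
    ∀ x y : ℝ, x ≠ 0 →
      interlaceQ E 𝓕 x y =
        ∑ F ∈ 𝓕, x ^ F.card * (1 + y / x) ^ numActOr 𝓕 F F *
          (1 + x * y) ^ numActOr 𝓕 F (E \ F) := by
  intro x y hx
  exact main_aux x y hx E 𝓕 hne hsub hex
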